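/- arXiv:1402.3383 — 4 statements merged into one kernel-verified Lean document; each statement's English description precedes it below -/
import Mathlib

section
/- (Erdős–Heilbronn conjecture) Let F be a field and A a finite subset of F with |A| ≥ 2. Then |{a + b : a, b ∈ A, a ≠ b}| ≥ min{p(F), 2|A| − 3}. -/
open Finset

namespace EH
open MvPolynomial

noncomputable def e (i j : ℕ) : Fin 2 →₀ ℕ := Finsupp.single 0 i + Finsupp.single 1 j

lemma e_zero (i j : ℕ) : e i j 0 = i := by simp [e]
lemma e_one (i j : ℕ) : e i j 1 = j := by simp [e]
lemma e_deg (i j : ℕ) : (e i j).degree = i + j := by simp [e]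

lemma e_s0 (i j : ℕ) : e (i+1) j = Finsupp.single 0 1 + e i j := by
  ext k; fin_cases k <;> simp [e, add_comm]
lemma e_s1 (i j : ℕ) : e i (j+1) = Finsupp.single 1 1 + e i j := by
  ext k; fin_cases k <;> simp [e, add_comm]

variable {F : Type*} [Field F]

lemma c0s (i j : ℕ) (p : MvPolynomial (Fin 2) F) : coeff (e (i+1) j) (X 0 * p) = coeff (e i j) p := by
  rw [e_s0, coeff_X_mul]
lemma c1s (i j : ℕ) (p : MvPolynomial (Fin 2) F) : coeff (e i (j+1)) (X 1 * p) = coeff (e i j) p := by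
  rw [e_s1, coeff_X_mul]
lemma c0z (j : ℕ) (p : MvPolynomial (Fin 2) F) : coeff (e 0 j) (X 0 * p) = 0 := by
  rw [coeff_X_mul', if_neg]; simp [e_zero]
lemma c1z (i : ℕ) (p : MvPolynomial (Fin 2) F) : coeff (e i 0) (X 1 * p) = 0 := by
  rw [coeff_X_mul', if_neg]; simp [e_one]

noncomputable def L (s : Multiset F) : MvPolynomial (Fin 2) F :=
  (s.map fun c => X 0 + X 1 - C c).prod

lemma L_deg (s : Multiset F) : (L s).totalDegree ≤ s.card := by
  induction s using Multiset.induction_on with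
  | empty => simp [L]
  | cons c s ih =>
    have : L (c ::ₘ s) = (X 0 + X 1 - C c) * L s := by simp [L]
    rw [this, Multiset.card_cons]
    refine (totalDegree_mul _ _).trans ?_
    have : (X 0 + X 1 - C c : MvPolynomial (Fin 2) F).totalDegree ≤ 1 := by
      refine (totalDegree_sub _ _).trans ?_
      simp only [totalDegree_C, max_le_iff]
      refine ⟨(totalDegree_add _ _).trans ?_, by simp⟩
      simp [totalDegree_X]
    omega

lemma L_coeff (s : Multiset F) : ∀ i j, i + j = s.card → coeff (e i j) (L s) = (s.card.choose i : F) := by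
  induction s using Multiset.induction_on with
  | empty =>
    intro i j h
    obtain ⟨rfl, rfl⟩ : i = 0 ∧ j = 0 := by simpa using h
    simp [L, e]
  | cons c s ih =>
    intro i j h
    have h1 : L (c ::ₘ s) = X 0 * L s + X 1 * L s - C c * L s := by simp [L]; ring
    rw [Multiset.card_cons] at h ⊢
    have h2 : coeff (e i j) (L s) = 0 := by
      apply coeff_eq_zero_of_totalDegree_lt
      have := L_deg s
      have h3 := e_deg i j
      rw [Finsupp.degree_apply] at h3
      omega
    rw [h1, coeff_sub, coeff_add, coeff_C_mul, h2]
    rcases i with _ | i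
    · obtain ⟨j, rfl⟩ : ∃ j', j = j' + 1 := ⟨j - 1, by omega⟩
      rw [c0z, c1s, ih _ _ (by omega)]; simp
    · rcases j with _ | j
      · rw [c0s, c1z, ih _ _ (by omega)]
        obtain rfl : i = s.card := by omega
        simp
      · rw [c0s, c1s, ih _ _ (by omega), ih _ _ (by omega), Nat.choose_succ_succ]
        push_cast; ring

lemma key [DecidableEq F] (A : Finset F) (n : ℕ) (hA : A.card = n + 2)
    (hn : (((2*n).factorial : ℕ) : F) ≠ 0) :
    2 * n + 1 ≤ (((A ×ˢ A).filter fun p => p.1 ≠ p.2).image fun p => p.1 + p.2).card := by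
  set S := (((A ×ˢ A).filter fun p => p.1 ≠ p.2).image fun p => p.1 + p.2) with hS
  by_contra! hlt
  obtain ⟨s, hs, hsc⟩ : ∃ s : Multiset F, s.card = 2 * n ∧ ∀ c ∈ S, c ∈ s :=
    ⟨S.val + Multiset.replicate (2*n - S.card) 0, by simp; omega, fun c hc => by simp [hc]⟩
  obtain ⟨a, ha⟩ : A.Nonempty := by rw [← Finset.card_pos]; omega
  have hco : coeff (e (n+1) n) ((X 0 - X 1) * L s) ≠ 0 := by
    rw [sub_mul, coeff_sub, c0s, L_coeff s n n (by omega)]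
    have h1 : coeff (e (n+1) n) (X 1 * L s) = ((2*n).choose (n+1) : F) := by
      rcases n with _ | n
      · rw [c1z]; simp
      · rw [c1s, L_coeff s _ _ (by omega), hs]
    rw [h1, hs]
    intro h0
    have h2 : ((2*n).choose (n+1) : F) * (n+1) = (2*n).choose n * n := by
      have := Nat.choose_succ_right_eq (2*n) n
      rw [show 2*n-n = n by omega] at this
      have := congrArg (Nat.cast : ℕ → F) this
      push_cast at this
      exact this
    have h3 : ((2*n).choose n : F) = 0 := by linear_combination (n+1) * h0 + h2
    apply hn
    rw [← Nat.choose_mul_factorial_mul_factorial (show n ≤ 2*n by omega)]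
    push_cast
    rw [h3]; ring
  have hdeg : ((X 0 - X 1) * L s).totalDegree = (e (n+1) n).degree := by
    apply le_antisymm
    · rw [e_deg]
      refine (totalDegree_mul _ _).trans ?_
      have h1 : (X 0 - X 1 : MvPolynomial (Fin 2) F).totalDegree ≤ 1 :=
        (totalDegree_sub _ _).trans (by simp [totalDegree_X])
      have := L_deg s
      omega
    · rw [Finsupp.degree_apply]
      exact le_totalDegree (mem_support_iff.2 hco)
  obtain ⟨x, hx, hne⟩ := combinatorial_nullstellensatz_exists_eval_nonzero _ _ hco hdeg
    ![A, A.erase a] (by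
      intro i; fin_cases i
      · simp [e_zero, hA]
      · simp [e_one, ha, hA])
  have h0 : x 0 ∈ A := by simpa using hx 0
  have h1 : x 1 ∈ A := by have := hx 1; simp at this; exact this.2
  apply hne
  rw [map_mul]
  by_cases hxx : x 0 = x 1
  · simp [hxx]
  · have : x 0 + x 1 ∈ s := hsc _ (by
      rw [hS]; exact mem_image.2 ⟨(x 0, x 1), by simp [h0, h1, hxx], rfl⟩)
    have : eval x (L s) = 0 := by
      rw [L, map_multiset_prod, Multiset.map_map]
      apply Multiset.prod_eq_zero
      exact Multiset.mem_map.2 ⟨_, this, by simp⟩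
    rw [this, mul_zero]

end EH

/-- Erdős–Heilbronn conjecture: `|{a + b : a, b ∈ A, a ≠ b}| ≥ min{p(F), 2|A| - 3}`;
`ringChar F = 0` encodes `p(F)` infinite. -/
theorem erdos_heilbronn {F : Type*} [Field F] [DecidableEq F]
    (A : Finset F) (hA : 2 ≤ A.card) :
    (ringChar F = 0 →
      2 * (A.card : ℤ) - 3 ≤
        (((A ×ˢ A).filter fun p => p.1 ≠ p.2).image fun p => p.1 + p.2).card) ∧
    (ringChar F ≠ 0 →
      min ((ringChar F : ℤ)) (2 * (A.card : ℤ) - 3) ≤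
        (((A ×ˢ A).filter fun p => p.1 ≠ p.2).image fun p => p.1 + p.2).card) := by
  obtain ⟨n, hn⟩ : ∃ n, A.card = n + 2 := ⟨A.card - 2, by omega⟩
  constructor
  · intro h
    have := EH.key A n hn (by
      rw [Ne, ringChar.spec, h, zero_dvd_iff]; exact Nat.factorial_ne_zero _)
    omega
  · intro h
    have hp : (ringChar F).Prime := (CharP.char_is_prime_or_zero F (ringChar F)).resolve_right h
    have hfac : ∀ m, m < ringChar F → ((m.factorial : ℕ) : F) ≠ 0 := by
      intro m hm
      rw [Ne, ringChar.spec, hp.dvd_factorial]; omega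
    by_cases hlt : 2 * n < ringChar F
    · have := EH.key A n hn (hfac _ hlt)
      omega
    · apply (min_le_left _ _).trans
      rcases hp.eq_two_or_odd' with h2 | ⟨m, hm⟩
      · rw [h2]
        obtain ⟨a, ha, b, hb, c, hc, hab, hac, hbc⟩ := Finset.two_lt_card.1 (show 2 < A.card by omega)
        have : 1 < (((A ×ˢ A).filter fun p => p.1 ≠ p.2).image fun p => p.1 + p.2).card := by
          rw [Finset.one_lt_card]
          exact ⟨a + b, mem_image.2 ⟨(a, b), by simp [*], rfl⟩,
            a + c, mem_image.2 ⟨(a, c), by simp [*], rfl⟩, by simpa using hbc⟩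
        exact_mod_cast this
      · obtain ⟨B, hB, hBc⟩ := Finset.exists_subset_card_eq (show m + 2 ≤ A.card by omega)
        have h1 := EH.key B m hBc (hfac _ (by omega))
        have h2 := Finset.card_le_card (Finset.image_subset_image (f := fun p : F × F => p.1 + p.2)
          (Finset.filter_subset_filter (fun p : F × F => p.1 ≠ p.2) (Finset.product_subset_product hB hB)))
        rw [hm]
        exact_mod_cast h1.trans h2
end

section
/- (Alon–Nathanson–Ruzsa) Let F be a field and A_1, ..., A_n finite subsets of F with 0 < |A_1| < |A_2| < ... < |A_n|, where |A_j| = k_j. Then |{a_1 + ... + a_n : a_j ∈ A_j for all j, and a_1, ..., a_n pairwise distinct}| ≥ min{p(F), Σ_{j=1}^n (k_j − j) + 1}. -/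
open Finset

open MvPolynomial in
lemma anr_term {F : Type*} [Field F] {n : ℕ} (c : Fin n → ℕ) (m : ℕ)
    (hm : m + ∑ i : Fin n, (i : ℕ) = ∑ i, c i) (σ : Equiv.Perm (Fin n)) :
    coeff (Finsupp.equivFunOnFinite.symm c)
      ((∑ i, X i : MvPolynomial (Fin n) F) ^ m * ∏ i, X i ^ (σ i : ℕ)) * ∏ i, ((c i).factorial : F)
      = m.factorial * ∏ i, ((c i).descFactorial (σ i : ℕ) : F) := by
  classical
  have h1 : (∏ i, X i ^ (σ i : ℕ) : MvPolynomial (Fin n) F) =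
      monomial (Finsupp.equivFunOnFinite.symm fun i => (σ i : ℕ)) 1 := by
    rw [monomial_eq, Finsupp.prod_fintype]
    · simp
    · simp
  rw [h1, coeff_mul_monomial']
  split_ifs with h
  · have hle : ∀ i, (σ i : ℕ) ≤ c i := fun i => h i
    have hsum : ∑ i, (c i - (σ i : ℕ)) = m := by
      have h2 : ∑ i, (σ i : ℕ) = ∑ i : Fin n, (i : ℕ) := Equiv.sum_comp σ (fun i => (i : ℕ))
      have h3 : ∑ i, (c i - (σ i : ℕ)) + ∑ i, (σ i : ℕ) = ∑ i, c i := by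
        rw [← Finset.sum_add_distrib]
        exact Finset.sum_congr rfl fun i _ => Nat.sub_add_cancel (hle i)
      omega
    rw [coeff_sum_X_pow_of_fintype, if_pos]
    · set d : Fin n →₀ ℕ := Finsupp.equivFunOnFinite.symm c -
        Finsupp.equivFunOnFinite.symm fun i => (σ i : ℕ) with hd
      have hdi : ∀ i, d i = c i - (σ i : ℕ) := fun i => rfl
      have hmul : d.multinomial = Nat.multinomial univ (fun i => c i - (σ i : ℕ)) := by
        rw [Finsupp.multinomial_eq_of_support_subset (Finset.subset_univ _)]
        rfl
      have hs := Nat.multinomial_spec univ (fun i => c i - (σ i : ℕ))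
      rw [hsum, ← hmul] at hs
      rw [← hs, mul_one]
      push_cast
      have : ∀ i, ((c i).factorial : F) = ((c i - (σ i : ℕ)).factorial : F) * ((c i).descFactorial (σ i : ℕ) : F) := by
        intro i
        rw [← Nat.factorial_mul_descFactorial (hle i)]
        push_cast; ring
      rw [Finset.prod_congr rfl fun i _ => this i, Finset.prod_mul_distrib]
      ring
    · rw [Finsupp.sum_fintype _ _ (by simp)]
      exact hsum
  · have : ∃ i, c i < (σ i : ℕ) := by
      by_contra hh
      push Not at hh
      exact h hh
    obtain ⟨i, hi⟩ := this
    rw [Finset.prod_eq_zero (f := fun i => ((c i).descFactorial (σ i : ℕ) : F)) (mem_univ i)]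
    · simp
    · simp [Nat.descFactorial_eq_zero_iff_lt.2 hi]

open MvPolynomial in
lemma anr_coeff {F : Type*} [Field F] {n : ℕ} (c : Fin n → ℕ) (m : ℕ)
    (hm : m + ∑ i : Fin n, (i : ℕ) = ∑ i, c i) :
    coeff (Finsupp.equivFunOnFinite.symm c)
      ((∑ i, X i : MvPolynomial (Fin n) F) ^ m *
        (Matrix.vandermonde (X : Fin n → MvPolynomial (Fin n) F)).det) * ∏ i, ((c i).factorial : F)
      = m.factorial * ∏ i : Fin n, ∏ j ∈ Ioi i, ((c j : F) - (c i : F)) := by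
  classical
  rw [← Matrix.det_vandermonde (fun i => (c i : F)),
    Matrix.det_eval_matrixOfPolynomials_eq_det_vandermonde (fun i => (c i : F))
      (fun i => descPochhammer F i) (fun i => descPochhammer_natDegree F i)
      (fun i => monic_descPochhammer F i), ← Matrix.det_transpose, Matrix.det_apply',
    ← Matrix.det_transpose, Matrix.det_apply', Finset.mul_sum, coeff_sum, Finset.sum_mul,
    Finset.mul_sum]
  refine Finset.sum_congr rfl fun σ _ => ?_
  have := anr_term (F := F) c m hm σ
  simp only [Matrix.transpose_apply, Matrix.vandermonde_apply, Matrix.of_apply,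
    descPochhammer_eval_eq_descFactorial]
  rw [mul_left_comm ((m.factorial : F)), ← this, mul_left_comm, ← mul_assoc (((Equiv.Perm.sign σ : ℤˣ) : ℤ) : F)]
  congr 1
  have h2 : (((Equiv.Perm.sign σ : ℤˣ) : ℤ) : MvPolynomial (Fin n) F) = C (((Equiv.Perm.sign σ : ℤˣ) : ℤ) : F) := by
    simp
  rw [h2, coeff_C_mul]

open MvPolynomial in
lemma anr_lin_deg {F : Type*} [Field F] {n : ℕ} (e : F) :
    ((∑ i, X i : MvPolynomial (Fin n) F) - C e).totalDegree ≤ 1 := by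
  refine (totalDegree_sub _ _).trans (max_le ?_ (by simp))
  exact totalDegree_finsetSum_le fun i _ => by simp

open MvPolynomial in
lemma anr_lower {F : Type*} [Field F] {n : ℕ} (d : Fin n →₀ ℕ) (E : Multiset F) :
    ∀ (G : MvPolynomial (Fin n) F) (N : ℕ), G.totalDegree ≤ N → d.degree = N + Multiset.card E →
    coeff d (G * (E.map fun e => (∑ i, X i : MvPolynomial (Fin n) F) - C e).prod) =
      coeff d (G * (∑ i, X i) ^ (Multiset.card E)) := by
  induction E using Multiset.induction with
  | empty => intro G N _ _; simp
  | cons e E ih =>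
    intro G N hG hd
    rw [Multiset.card_cons] at hd
    rw [Multiset.map_cons, Multiset.prod_cons, ← mul_assoc, ih _ (N + 1), Multiset.card_cons]
    · have : G * (∑ i, X i - C e) * (∑ i, X i) ^ (Multiset.card E) =
        G * (∑ i, X i) ^ (Multiset.card E + 1) - C e * (G * (∑ i, X i) ^ (Multiset.card E)) := by
        ring
      rw [this, coeff_sub, coeff_C_mul, coeff_eq_zero_of_totalDegree_lt (f := G * (∑ i, X i) ^ (Multiset.card E)), mul_zero, sub_zero]
      have h1 : (∑ i, X i : MvPolynomial (Fin n) F).totalDegree ≤ 1 := by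
        simpa using anr_lin_deg (F := F) (n := n) 0
      have h2 := totalDegree_mul G ((∑ i, X i) ^ (Multiset.card E))
      have h3 := totalDegree_pow (∑ i, X i : MvPolynomial (Fin n) F) (Multiset.card E)
      have h4 : Multiset.card E * (∑ i, X i : MvPolynomial (Fin n) F).totalDegree ≤ Multiset.card E * 1 :=
        Nat.mul_le_mul_left _ h1
      change _ < d.degree
      omega
    · exact (totalDegree_mul _ _).trans (add_le_add hG (anr_lin_deg e))
    · omega

open MvPolynomial in
lemma anr_vdeg {F : Type*} [Field F] {n : ℕ} :
    (Matrix.vandermonde (X : Fin n → MvPolynomial (Fin n) F)).det.totalDegree ≤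
      ∑ i : Fin n, (i : ℕ) := by
  rw [← Matrix.det_transpose, Matrix.det_apply']
  refine totalDegree_finsetSum_le fun σ _ => ?_
  have h2 : (((Equiv.Perm.sign σ : ℤˣ) : ℤ) : MvPolynomial (Fin n) F) = C (((Equiv.Perm.sign σ : ℤˣ) : ℤ) : F) := by
    simp
  rw [h2]
  refine (totalDegree_mul _ _).trans ?_
  rw [totalDegree_C, zero_add]
  refine (totalDegree_finsetProd _ _).trans ?_
  rw [← Equiv.sum_comp σ (fun i => (i : ℕ))]
  refine Finset.sum_le_sum fun i _ => ?_
  simp [Matrix.vandermonde_apply]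

open MvPolynomial in
lemma anr_core {F : Type*} [Field F] [DecidableEq F] {n : ℕ}
    (A : Fin n → Finset F) (c : Fin n → ℕ) (hc : ∀ i, c i < (A i).card) (m : ℕ)
    (hm : m + ∑ i : Fin n, (i : ℕ) = ∑ i, c i)
    (h0 : (m.factorial * ∏ i : Fin n, ∏ j ∈ Ioi i, ((c j : F) - (c i : F)) : F) ≠ 0) :
    m + 1 ≤ (((Fintype.piFinset A).filter fun f => Function.Injective f).image
          fun f => ∑ i, f i).card := by
  classical
  by_contra hlt
  set S := ((Fintype.piFinset A).filter fun f => Function.Injective f).image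
          fun f => ∑ i, f i with hS
  set E : Multiset F := S.val + Multiset.replicate (m - S.card) 0 with hE
  have hcard : Multiset.card E = m := by
    simp [hE]; omega
  set d : Fin n →₀ ℕ := Finsupp.equivFunOnFinite.symm c with hd
  have hdeg : d.degree = ∑ i, c i := by
    rw [Finsupp.degree_eq_sum]; rfl
  set V := (Matrix.vandermonde (X : Fin n → MvPolynomial (Fin n) F)).det with hV
  set P := V * (E.map fun e => (∑ i, X i : MvPolynomial (Fin n) F) - C e).prod with hP
  have hco : coeff d P ≠ 0 := by
    rw [hP, anr_lower d E V _ anr_vdeg (by omega), hcard, mul_comm]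
    intro h
    apply h0
    rw [← anr_coeff c m hm, h, zero_mul]
  have hPd : P.totalDegree = d.degree := by
    apply le_antisymm
    · refine (totalDegree_mul _ _).trans ?_
      have h1 : V.totalDegree ≤ _ := anr_vdeg (F := F) (n := n)
      have h2 : (E.map fun e => (∑ i, X i : MvPolynomial (Fin n) F) - C e).prod.totalDegree ≤ m := by
        refine (totalDegree_multiset_prod _).trans ?_
        rw [Multiset.map_map]
        refine (Multiset.sum_le_card_nsmul _ 1 ?_).trans (by simp [hcard])
        intro x hx
        obtain ⟨e, _, rfl⟩ := Multiset.mem_map.1 hx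
        exact anr_lin_deg e
      omega
    · exact le_totalDegree (mem_support_iff.2 hco)
  obtain ⟨s, hs, hne⟩ := combinatorial_nullstellensatz_exists_eval_nonzero P d hco hPd A hc
  rw [hP, map_mul] at hne
  have hV0 := left_ne_zero_of_mul hne
  have hE0 := right_ne_zero_of_mul hne
  have hinj : Function.Injective s := by
    rw [hV, Matrix.det_vandermonde, ← Matrix.det_vandermonde, RingHom.map_det] at hV0
    have : (eval s).mapMatrix (Matrix.vandermonde (X : Fin n → MvPolynomial (Fin n) F)) = Matrix.vandermonde s := by
      ext i j
      simp [Matrix.vandermonde_apply]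
    rw [this] at hV0
    exact Matrix.det_vandermonde_ne_zero_iff.1 hV0
  apply hE0
  rw [map_multiset_prod, Multiset.map_map]
  apply Multiset.prod_eq_zero
  refine Multiset.mem_map.2 ⟨∑ i, s i, ?_, ?_⟩
  · rw [hE, Multiset.mem_add]
    left
    rw [Finset.mem_val, hS]
    exact Finset.mem_image.2 ⟨s, Finset.mem_filter.2 ⟨Fintype.mem_piFinset.2 hs, hinj⟩, rfl⟩
  · simp

lemma anr_ge {n : ℕ} (c : Fin n → ℕ) (hc : StrictMono c) (i : Fin n) : (i : ℕ) ≤ c i := by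
  obtain ⟨k, hk⟩ := i
  induction k with
  | zero => exact Nat.zero_le _
  | succ k ih =>
    have h1 := ih (by omega)
    have h2 : c ⟨k, by omega⟩ < c ⟨k + 1, hk⟩ := hc (Fin.mk_lt_mk.2 (Nat.lt_succ_self k))
    simp only at h1 ⊢
    omega

lemma anr_main {F : Type*} [Field F] [DecidableEq F] {n : ℕ} : ∀ 
    (A : Fin n → Finset F) (c : Fin n → ℕ) (_ : ∀ i, c i < (A i).card) (_ : StrictMono c) (m : ℕ)
    (_ : m + ∑ i : Fin n, (i : ℕ) = ∑ i, c i)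
    (_ : ringChar F = 0 ∨ m < ringChar F),
    m + 1 ≤ (((Fintype.piFinset A).filter fun f => Function.Injective f).image
          fun f => ∑ i, f i).card := by
  induction n with
  | zero =>
    intro A c _ _ m hm _
    apply anr_core A c (fun i => i.elim0) m hm
    simp at hm
    simp [hm]
  | succ n ih =>
    intro A c hc hmono m hm hp
    have key : ∀ k : ℕ, 0 < k → k ≤ m → (k : F) ≠ 0 := by
      intro k hk hkm h
      rw [ringChar.spec] at h
      rcases hp with hp | hp
      · rw [hp, zero_dvd_iff] at h; omega
      · have := Nat.le_of_dvd hk h; omega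
    by_cases h0 : c 0 = 0
    · obtain ⟨a, ha⟩ : (A 0).Nonempty := Finset.card_pos.1 (by have := hc 0; omega)
      have hpos : ∀ j : Fin n, 0 < c j.succ := fun j => by
        have := hmono (Fin.succ_pos j); omega
      have h := ih (fun j => (A j.succ).erase a) (fun j => c j.succ - 1)
        (fun j => by
          have := hc j.succ
          have := Finset.pred_card_le_card_erase (s := A j.succ) (a := a)
          have := hpos j
          omega)
        (fun i j hij => by
          have := hmono (Fin.succ_lt_succ_iff.2 hij)
          have := hpos i
          have := hpos j
          simp only
          omega) m
        (by
          have e1 : ∑ j : Fin n, (c j.succ - 1) + n = ∑ j : Fin n, c j.succ := by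
            have : ∑ j : Fin n, c j.succ = ∑ j : Fin n, ((c j.succ - 1) + 1) :=
              Finset.sum_congr rfl fun j _ => by have := hpos j; omega
            rw [this, Finset.sum_add_distrib]; simp
          rw [Fin.sum_univ_succ, Fin.sum_univ_succ (f := c), h0] at hm
          simp only [Fin.val_succ, Finset.sum_add_distrib] at hm
          simp at hm
          omega) hp
      refine h.trans ?_
      rw [← Finset.card_image_of_injective _ (add_right_injective a)]
      apply Finset.card_le_card
      intro x hx
      simp only [Finset.mem_image, Finset.mem_filter, Fintype.mem_piFinset] at hx ⊢
      obtain ⟨y, ⟨f, ⟨hf, hinj⟩, rfl⟩, rfl⟩ := hx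
      refine ⟨Fin.cons a f, ⟨?_, ?_⟩, ?_⟩
      · intro i
        refine Fin.cases ?_ (fun j => ?_) i
        · simpa using ha
        · simpa using Finset.mem_of_mem_erase (hf j)
      · rw [Fin.cons_injective_iff]
        refine ⟨?_, hinj⟩
        rintro ⟨j, hj⟩
        exact Finset.ne_of_mem_erase (hf j) hj
      · simp [Fin.sum_univ_succ]
    · have hbig : ∀ j, c j ≤ m := by
        intro j
        have hge1 : ∀ i : Fin (n+1), (i : ℕ) + 1 ≤ c i := by
          intro i
          induction i using Fin.induction with
          | zero => simp; omega
          | succ i ihh =>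
            have := hmono (Fin.castSucc_lt_succ (i := i))
            simp at ihh ⊢; omega
        have e2 : ∑ i ∈ univ.erase j, ((i : ℕ) + 1) ≤ ∑ i ∈ univ.erase j, c i :=
          Finset.sum_le_sum fun i _ => hge1 i
        have e3 := Finset.add_sum_erase univ c (mem_univ j)
        have e4 := Finset.add_sum_erase univ (fun i : Fin (n+1) => (i : ℕ) + 1) (mem_univ j)
        rw [Finset.sum_add_distrib (s := univ)] at e4
        simp only [Finset.sum_const, Finset.card_univ, Fintype.card_fin, smul_eq_mul, mul_one] at e4
        have := j.isLt
        omega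
      apply anr_core A c hc m hm
      apply mul_ne_zero
      · rw [← Finset.prod_range_add_one_eq_factorial]
        push_cast
        rw [Finset.prod_ne_zero_iff]
        intro k hk
        have := key (k+1) (by omega) (by simpa using hk)
        exact_mod_cast this
      · rw [Finset.prod_ne_zero_iff]
        intro i _
        rw [Finset.prod_ne_zero_iff]
        intro j hj
        have hij := hmono (Finset.mem_Ioi.1 hj)
        rw [← Nat.cast_sub hij.le]
        exact key _ (by omega) (by have := hbig j; omega)

lemma anr_shrink {n : ℕ} (c : Fin n → ℕ) (hc : StrictMono c) (m : ℕ)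
    (hm : m + 1 + ∑ i : Fin n, (i : ℕ) = ∑ i, c i) :
    ∃ c' : Fin n → ℕ, StrictMono c' ∧ (∀ i, c' i ≤ c i) ∧
      m + ∑ i : Fin n, (i : ℕ) = ∑ i, c' i := by
  classical
  have hge := anr_ge c hc
  have hex : ∃ k : ℕ, ∃ h : k < n, k < c ⟨k, h⟩ := by
    by_contra hh
    push Not at hh
    have : ∑ i, c i ≤ ∑ i : Fin n, (i : ℕ) := Finset.sum_le_sum fun i _ => hh i i.isLt
    omega
  obtain ⟨hk, hlt⟩ := Nat.find_spec hex
  set i0 : Fin n := ⟨Nat.find hex, hk⟩ with hi0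
  have hmin : ∀ i < i0, c i = i := by
    intro i hi
    have := Nat.find_min hex (m := i) hi
    push Not at this
    exact le_antisymm (this i.isLt) (hge i)
  have hlt' : (i0 : ℕ) < c i0 := hlt
  refine ⟨Function.update c i0 (c i0 - 1), ?_, ?_, ?_⟩
  · intro i j hij
    have := hc hij
    by_cases h1 : i = i0
    · have h2 : j ≠ i0 := by rintro rfl; exact hij.ne h1
      subst h1
      rw [Function.update_self, Function.update_of_ne h2]; omega
    · rw [Function.update_of_ne h1]
      by_cases h2 : j = i0
      · subst h2
        rw [Function.update_self, hmin i hij]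
        have : (i : ℕ) < i0 := hij
        omega
      · rw [Function.update_of_ne h2]; exact this
  · intro i
    by_cases h1 : i = i0
    · subst h1; rw [Function.update_self]; omega
    · rw [Function.update_of_ne h1]
  · have e3 := Finset.add_sum_erase univ c (mem_univ i0)
    have e4 := Finset.add_sum_erase univ (Function.update c i0 (c i0 - 1)) (mem_univ i0)
    have e5 : ∑ i ∈ univ.erase i0, Function.update c i0 (c i0 - 1) i = ∑ i ∈ univ.erase i0, c i :=
      Finset.sum_congr rfl fun i hi => Function.update_of_ne (Finset.ne_of_mem_erase hi) _ _
    rw [Function.update_self] at e4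
    omega

lemma anr_shrink' {n : ℕ} (r m : ℕ) : ∀ (c : Fin n → ℕ) (_ : StrictMono c) 
    (_ : m + r + ∑ i : Fin n, (i : ℕ) = ∑ i, c i),
    ∃ c' : Fin n → ℕ, StrictMono c' ∧ (∀ i, c' i ≤ c i) ∧
      m + ∑ i : Fin n, (i : ℕ) = ∑ i, c' i := by
  induction r with
  | zero => intro c hc h; exact ⟨c, hc, fun _ => le_rfl, by simpa using h⟩
  | succ r ih =>
    intro c hc h
    obtain ⟨c1, h1, h2, h3⟩ := anr_shrink c hc (m + r) (by omega)
    obtain ⟨c2, h4, h5, h6⟩ := ih c1 h1 h3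
    exact ⟨c2, h4, fun i => (h5 i).trans (h2 i), h6⟩


/-- Alon–Nathanson–Ruzsa: if `0 < |A_1| < ⋯ < |A_n|` then the restricted sumset of sums of
pairwise distinct representatives has at least `min{p(F), Σ_j (|A_j| - j) + 1}` elements;
`ringChar F = 0` encodes `p(F)` infinite. -/
theorem alon_nathanson_ruzsa {F : Type*} [Field F] [DecidableEq F] {n : ℕ}
    (A : Fin n → Finset F) (hA : ∀ j, (A j).Nonempty)
    (hmono : ∀ i j : Fin n, i < j → (A i).card < (A j).card) :
    (ringChar F = 0 →
      (∑ j, (((A j).card : ℤ) - ((j : ℕ) + 1))) + 1 ≤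
        (((Fintype.piFinset A).filter fun f => Function.Injective f).image
          fun f => ∑ i, f i).card) ∧
    (ringChar F ≠ 0 →
      min ((ringChar F : ℤ)) ((∑ j, (((A j).card : ℤ) - ((j : ℕ) + 1))) + 1) ≤
        (((Fintype.piFinset A).filter fun f => Function.Injective f).image
          fun f => ∑ i, f i).card) := by
  have hpos : ∀ j, 0 < (A j).card := fun j => (hA j).card_pos
  set c : Fin n → ℕ := fun j => (A j).card - 1 with hc
  have hcm : StrictMono c := fun i j hij => by
    have := hmono i j hij
    have := hpos i
    simp only [hc]; omega
  have hcl : ∀ j, c j < (A j).card := fun j => by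
    have := hpos j
    simp only [hc]; omega
  have hle : ∑ i : Fin n, (i : ℕ) ≤ ∑ i, c i := Finset.sum_le_sum fun i _ => anr_ge c hcm i
  obtain ⟨m, hm⟩ : ∃ m, m + ∑ i : Fin n, (i : ℕ) = ∑ i, c i := ⟨_, Nat.sub_add_cancel hle⟩
  have hsum : (∑ j, (((A j).card : ℤ) - ((j : ℕ) + 1))) = m := by
    have : ∀ j, (((A j).card : ℤ) - ((j : ℕ) + 1)) = (c j : ℤ) - ((j : ℕ) : ℤ) := fun j => by
      have := hpos j
      simp only [hc]; omega
    rw [Finset.sum_congr rfl fun j _ => this j, Finset.sum_sub_distrib]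
    zify at hm
    linarith
  rw [hsum]
  constructor
  · intro h0
    exact_mod_cast anr_main A c hcl hcm m hm (Or.inl h0)
  · intro h0
    by_cases hlt : m < ringChar F
    · refine (min_le_right _ _).trans ?_
      exact_mod_cast anr_main A c hcl hcm m hm (Or.inr hlt)
    · refine (min_le_left _ _).trans ?_
      obtain ⟨c', h1, h2, h3⟩ := anr_shrink' (m - (ringChar F - 1)) (ringChar F - 1) c hcm
        (by omega)
      have := anr_main A c' (fun i => (h2 i).trans_lt (hcl i)) h1 (ringChar F - 1) h3
        (Or.inr (by omega))
      have h4 : ringChar F - 1 + 1 = ringChar F := by omega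
      rw [h4] at this
      exact_mod_cast this
end

section
/- Let p be a prime and A ⊆ Z/pZ with |A| > √(4p − 7). Then every element of Z/pZ is a sum of ⌊|A|/2⌋ pairwise distinct elements of A. -/
open Finset

open MvPolynomial in
lemma dsh_term {R : Type*} [CommRing R] {k : ℕ} (N : ℕ) (t s : Fin k →₀ ℕ)
    (h : N + ∑ i, s i = ∑ i, t i) :
    ((∏ i, (t i).factorial : ℕ) : R) *
      coeff t ((∑ i, X i : MvPolynomial (Fin k) R) ^ N * monomial s 1) =
    (N.factorial : R) * ((∏ i, (t i).descFactorial (s i) : ℕ) : R) := by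
  rw [coeff_mul_monomial']
  split_ifs with hs
  · have hsum : ∑ i, (t - s) i = N := by
      have : ∑ i, (t - s) i + ∑ i, s i = ∑ i, t i := by
        rw [← Finset.sum_add_distrib]
        refine Finset.sum_congr rfl fun i _ => ?_
        have := hs i
        simp only [Finsupp.coe_tsub, Pi.sub_apply]
        omega
      omega
    rw [coeff_sum_X_pow_of_fintype, if_pos (by rw [Finsupp.sum_fintype _ _ (by simp), hsum]),
      mul_one, ← Finsupp.multinomial_of_support_subset (Finset.subset_univ _)]
    have hm := Nat.multinomial_spec (Finset.univ) (t - s : Fin k →₀ ℕ)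
    rw [hsum] at hm
    rw [← hm]
    norm_cast
    rw [mul_right_comm, ← Finset.prod_mul_distrib]
    congr 2
    refine Finset.prod_congr rfl fun i _ => ?_
    exact (Nat.factorial_mul_descFactorial (hs i)).symm
  · have : ∃ i, t i < s i := by
      by_contra hc
      push Not at hc
      exact hs hc
    obtain ⟨i, hi⟩ := this
    have h0 : ∏ i, (t i).descFactorial (s i) = 0 :=
      Finset.prod_eq_zero (Finset.mem_univ i) (Nat.descFactorial_of_lt hi)
    rw [h0]
    simp

open MvPolynomial in
lemma dsh_coeff {R : Type*} [CommRing R] [IsDomain R] {k : ℕ} (N : ℕ) (t : Fin k →₀ ℕ)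
    (h : N + ∑ i : Fin k, (i : ℕ) = ∑ i, t i) :
    ((∏ i, (t i).factorial : ℕ) : R) *
      coeff t ((∑ i, X i : MvPolynomial (Fin k) R) ^ N *
        (Matrix.vandermonde (fun i : Fin k => (X i : MvPolynomial (Fin k) R))).det) =
    (N.factorial : R) * (Matrix.vandermonde (fun i : Fin k => ((t i : ℕ) : R))).det := by
  rw [Matrix.det_eval_matrixOfPolynomials_eq_det_vandermonde _ (fun i => descPochhammer R i)
    (fun i => descPochhammer_natDegree R i) (fun i => monic_descPochhammer R i)]
  rw [Matrix.det_apply', Matrix.det_apply', Finset.mul_sum, Finset.mul_sum, coeff_sum,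
    Finset.mul_sum]
  refine Finset.sum_congr rfl fun σ _ => ?_
  have hmon : ∏ i : Fin k, Matrix.vandermonde (fun i : Fin k => (X i : MvPolynomial (Fin k) R))
      (σ i) i = monomial (Finsupp.equivFunOnFinite.symm (fun j => ((σ⁻¹ j : Fin k) : ℕ))) 1 := by
    rw [monomial_eq, Finsupp.prod_fintype _ _ (by simp)]
    conv_rhs => rw [← Equiv.prod_comp σ]
    simp [Matrix.vandermonde_apply]
  have hterm := dsh_term (R := R) N t
    (Finsupp.equivFunOnFinite.symm (fun j => ((σ⁻¹ j : Fin k) : ℕ))) (by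
      rw [← h, ← Equiv.sum_comp σ]; simp)
  rw [← hmon] at hterm
  have hsgn : (((Equiv.Perm.sign σ : ℤˣ) : ℤ) : MvPolynomial (Fin k) R)
      = C (((Equiv.Perm.sign σ : ℤˣ) : ℤ) : R) := by simp
  rw [hsgn, mul_left_comm, coeff_C_mul, mul_left_comm, hterm, mul_left_comm]
  congr 2
  rw [← Equiv.prod_comp σ]
  simp [descPochhammer_eval_eq_descFactorial]

lemma dsh_exponents (k n M : ℕ) (hk : 0 < k) (hkn : k ≤ n) (hM : M ≤ k * (n - k)) :
    ∃ t : Fin k → ℕ, Function.Injective t ∧ (∀ i, t i < n) ∧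
      M + ∑ i : Fin k, (i : ℕ) = ∑ i, t i := by
  have hdm := Nat.div_add_mod M k
  have hr := Nat.mod_lt M hk
  set q := M / k
  set r := M % k
  have hq : q + (if 0 < r then 1 else 0) ≤ n - k := by
    split_ifs with h0
    · by_contra hc
      have : n - k ≤ q := by omega
      have := Nat.mul_le_mul_left k this
      omega
    · by_contra hc
      have : n - k + 1 ≤ q := by omega
      have := Nat.mul_le_mul_left k this
      rw [mul_add] at this
      omega
  refine ⟨fun i => i + (q + if k - r ≤ (i : ℕ) then 1 else 0), ?_, ?_, ?_⟩
  · intro i j hij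
    ext
    simp only at hij
    split_ifs at hij <;> omega
  · intro i
    have := i.2
    simp only
    split_ifs at hq ⊢ <;> omega
  · rw [Finset.sum_add_distrib, Finset.sum_add_distrib]
    have h1 : ∑ i : Fin k, (if k - r ≤ (i : ℕ) then 1 else 0) = r := by
      rw [Fin.sum_univ_eq_sum_range (fun i => if k - r ≤ i then 1 else 0) k,
        ← Finset.card_filter]
      have : (range k).filter (fun i => k - r ≤ i) = Ico (k - r) k := by
        ext x
        simp only [Finset.mem_filter, Finset.mem_range, Finset.mem_Ico]
        omega
      rw [this, Nat.card_Ico]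
      omega
    rw [h1]
    simp only [Finset.sum_const, Finset.card_univ, Fintype.card_fin, smul_eq_mul]
    omega

open MvPolynomial in
lemma dsh_main {p : ℕ} [Fact p.Prime] (A : Finset (ZMod p)) (k : ℕ) (hk : 0 < k)
    (hkn : k ≤ #A) (hM : p - 1 ≤ k * (#A - k)) (c : ZMod p) :
    ∃ a : Fin k → ZMod p, Function.Injective a ∧ (∀ i, a i ∈ A) ∧ ∑ i, a i = c := by
  have hp : p.Prime := Fact.out
  have hp2 := hp.two_le
  have hcard : #A ≤ p := by simpa [ZMod.card] using Finset.card_le_univ A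
  obtain ⟨t', hinj, hlt, hsum⟩ := dsh_exponents k (#A) (p - 1) hk hkn hM
  set t : Fin k →₀ ℕ := Finsupp.equivFunOnFinite.symm t' with ht
  have htt : ∀ i, t i = t' i := fun i => rfl
  have hdeg : t.degree = p - 1 + ∑ i : Fin k, (i : ℕ) := by
    rw [Finsupp.degree_eq_sum, hsum]; rfl
  set V : MvPolynomial (Fin k) (ZMod p) := (Matrix.vandermonde (fun i : Fin k => X i)).det with hV
  set S : MvPolynomial (Fin k) (ZMod p) := ∑ i, X i with hS
  have hVh : V.IsHomogeneous (∑ i : Fin k, (i : ℕ)) := by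
    rw [hV, Matrix.det_apply']
    refine IsHomogeneous.sum _ _ _ fun σ _ => ?_
    have hsgn : (((Equiv.Perm.sign σ : ℤˣ) : ℤ) : MvPolynomial (Fin k) (ZMod p))
      = C (((Equiv.Perm.sign σ : ℤˣ) : ℤ) : ZMod p) := by simp
    rw [hsgn]
    refine IsHomogeneous.C_mul (IsHomogeneous.prod _ _ _ fun i _ => ?_) _
    exact isHomogeneous_X_pow _ _
  have hSh : S.IsHomogeneous 1 := IsHomogeneous.sum _ _ _ fun i _ => isHomogeneous_X _ _
  have hc1 : coeff t (S ^ (p - 1) * V) ≠ 0 := by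
    intro h0
    have := dsh_coeff (R := ZMod p) (p - 1) t hsum
    rw [← hS, ← hV, h0, mul_zero] at this
    rcases mul_eq_zero.1 this.symm with h1 | h1
    · rw [ZMod.natCast_eq_zero_iff, hp.dvd_factorial] at h1
      omega
    · refine (Matrix.det_vandermonde_ne_zero_iff.2 ?_) h1
      intro i j hij
      have := (ZMod.natCast_eq_natCast_iff' _ _ _).1 hij
      rw [Nat.mod_eq_of_lt (by rw [htt]; exact (hlt i).trans_le hcard),
        Nat.mod_eq_of_lt (by rw [htt]; exact (hlt j).trans_le hcard)] at this
      exact hinj this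
  have hc2 : coeff t ((S - C c) ^ (p - 1) * V) = coeff t (S ^ (p - 1) * V) := by
    rw [sub_eq_add_neg, add_pow, Finset.sum_mul, coeff_sum,
      Finset.sum_eq_single_of_mem (p - 1) (by simp)]
    · simp
    · intro m hm hne
      have : S ^ m * (-C c) ^ (p - 1 - m) * ((p - 1).choose m : MvPolynomial (Fin k) (ZMod p)) * V
        = C ((-c) ^ (p - 1 - m) * ((p - 1).choose m : ZMod p)) * (S ^ m * V) := by
        simp; ring
      rw [this, coeff_C_mul, ((hSh.pow m).mul hVh).coeff_eq_zero, mul_zero]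
      rw [hdeg]
      omega
  set f := (1 - (S - C c) ^ (p - 1)) * V with hf
  have hcf : coeff t f ≠ 0 := by
    rw [hf, sub_mul, one_mul, coeff_sub, hVh.coeff_eq_zero (by rw [hdeg]; omega), hc2, zero_sub]
    exact neg_ne_zero.2 hc1
  have hdf : f.totalDegree = t.degree := by
    apply le_antisymm
    · rw [hdeg]
      refine (totalDegree_mul _ _).trans (add_le_add ?_ hVh.totalDegree_le)
      refine (totalDegree_sub _ _).trans (max_le (by simp) ?_)
      refine (totalDegree_pow _ _).trans ?_
      have : (S - C c).totalDegree ≤ 1 :=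
        (totalDegree_sub _ _).trans (max_le hSh.totalDegree_le (by simp))
      nlinarith
    · have := le_totalDegree (mem_support_iff.2 hcf)
      rwa [Finsupp.degree_eq_sum, ← Finsupp.sum_fintype t (fun _ e => e) (by simp)]
  obtain ⟨a, haA, hne⟩ := combinatorial_nullstellensatz_exists_eval_nonzero f t hcf hdf
    (fun _ => A) (fun i => hlt i)
  rw [hf, map_mul] at hne
  have h1 := left_ne_zero_of_mul hne
  have h2 := right_ne_zero_of_mul hne
  refine ⟨a, ?_, haA, ?_⟩
  · apply Matrix.det_vandermonde_ne_zero_iff.1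
    convert h2
    rw [hV, RingHom.map_det]
    congr 1
    ext i j
    simp [Matrix.vandermonde_apply]
  · by_contra hcc
    apply h1
    have : (∑ i, a i) - c ≠ 0 := sub_ne_zero.2 hcc
    simp [hS, ZMod.pow_card_sub_one_eq_one this]

/-- Dias da Silva–Hamidoune: if `|A| > √(4p-7)` then every element of `ℤ/pℤ` is a sum of
`⌊|A|/2⌋` pairwise distinct elements of `A`. -/
theorem zmod_distinct_representation {p : ℕ} (hp : p.Prime) (A : Finset (ZMod p))
    (hA : Real.sqrt (4 * p - 7) < (A.card : ℝ)) :
    ∀ c : ZMod p, ∃ a : Fin (A.card / 2) → ZMod p,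
      Function.Injective a ∧ (∀ i, a i ∈ A) ∧ ∑ i, a i = c := by
  intro c
  have : Fact p.Prime := ⟨hp⟩
  have hp2 := hp.two_le
  have h1 : (4 * p - 7 : ℝ) < (#A : ℝ) ^ 2 := Real.lt_sq_of_sqrt_lt hA
  have h2 : 4 * p < #A ^ 2 + 7 := by
    have : (4 * p : ℝ) < (#A : ℝ) ^ 2 + 7 := by linarith
    exact_mod_cast this
  apply dsh_main A _ _ (Nat.div_le_self _ _)
  · rcases Nat.even_or_odd' (#A) with ⟨m, hm | hm⟩
    · rw [hm] at h2 ⊢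
      have e1 : 2 * m / 2 = m := by omega
      have e2 : 2 * m - m = m := by omega
      rw [e1, e2]
      have : p < m * m + 2 := by nlinarith
      omega
    · rw [hm] at h2 ⊢
      have e1 : (2 * m + 1) / 2 = m := by omega
      have e2 : 2 * m + 1 - m = m + 1 := by omega
      rw [e1, e2]
      have : p < m * (m + 1) + 2 := by nlinarith
      omega
  · by_contra hc
    have : #A ≤ 1 := by omega
    nlinarith
end

section
/- Let F be a field and C = {a_1 + ... + a_n : a_j ∈ A_j, a_i − a_j ∉ S_{ij} if i ≠ j} with |S_{ij}| = m and |A_j| = k for all j. Suppose p(F) > mn and p(F) ≤ n(k−1) − mn(n−1). Then |C| ≥ p(F); in particular C = F when F is finite of prime order. -/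
open Finset

lemma rs_prod_deg {σ ι F : Type*} [Field F] (s : Finset ι) (L : ι → MvPolynomial σ F)
    (hL : ∀ i, (L i).totalDegree ≤ 1) (b : ι → F) :
    (∏ i ∈ s, (L i - MvPolynomial.C (b i))).totalDegree ≤ s.card := by
  refine (MvPolynomial.totalDegree_finsetProd _ _).trans ?_
  refine (Finset.sum_le_card_nsmul _ _ 1 ?_).trans (by simp)
  intro i _
  exact (MvPolynomial.totalDegree_sub _ _).trans (by simp [hL i])

lemma rs_key {σ ι F : Type*} [Field F] (s : Finset ι) (L : ι → MvPolynomial σ F)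
    (hL : ∀ i, (L i).totalDegree ≤ 1) (b b' : ι → F) :
    (∏ i ∈ s, (L i - MvPolynomial.C (b i)) - ∏ i ∈ s, (L i - MvPolynomial.C (b' i)) = 0) ∨
    (∏ i ∈ s, (L i - MvPolynomial.C (b i)) - ∏ i ∈ s, (L i - MvPolynomial.C (b' i))).totalDegree
      < s.card := by
  classical
  induction s using Finset.induction_on with
  | empty => left; simp
  | insert a s ha ih =>
    right
    rw [prod_insert ha, prod_insert ha, card_insert_of_notMem ha]
    set P := ∏ i ∈ s, (L i - MvPolynomial.C (b i)) with hP
    set Q := ∏ i ∈ s, (L i - MvPolynomial.C (b' i)) with hQ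
    have hPd : P.totalDegree ≤ s.card := rs_prod_deg s L hL b
    have hQd : Q.totalDegree ≤ s.card := rs_prod_deg s L hL b'
    have e : (L a - MvPolynomial.C (b a)) * P - (L a - MvPolynomial.C (b' a)) * Q
      = L a * (P - Q) - (MvPolynomial.C (b a) * P - MvPolynomial.C (b' a) * Q) := by ring
    rw [e]
    have h1 : (L a * (P - Q)).totalDegree ≤ s.card := by
      rcases ih with h | h
      · rw [h]; simp
      · refine (MvPolynomial.totalDegree_mul _ _).trans ?_
        have := hL a
        omega
    have h2 : (MvPolynomial.C (b a) * P).totalDegree ≤ s.card := by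
      refine (MvPolynomial.totalDegree_mul _ _).trans ?_
      simpa using hPd
    have h3 : (MvPolynomial.C (b' a) * Q).totalDegree ≤ s.card := by
      refine (MvPolynomial.totalDegree_mul _ _).trans ?_
      simpa using hQd
    have h4 := MvPolynomial.totalDegree_sub (MvPolynomial.C (b a) * P) (MvPolynomial.C (b' a) * Q)
    have h5 := MvPolynomial.totalDegree_sub (L a * (P - Q))
      (MvPolynomial.C (b a) * P - MvPolynomial.C (b' a) * Q)
    have h6 := h4.trans (max_le h2 h3)
    have h7 := h5.trans (max_le h1 h6)
    omega

lemma rs_coeff {σ ι F : Type*} [Field F] (s : Finset ι) (L : ι → MvPolynomial σ F)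
    (hL : ∀ i, (L i).totalDegree ≤ 1) (b b' : ι → F) (d : σ →₀ ℕ) (hd : d.degree = s.card) :
    MvPolynomial.coeff d (∏ i ∈ s, (L i - MvPolynomial.C (b i))) =
    MvPolynomial.coeff d (∏ i ∈ s, (L i - MvPolynomial.C (b' i))) := by
  rw [← sub_eq_zero, ← MvPolynomial.coeff_sub]
  rcases rs_key s L hL b b' with h | h
  · rw [h]; simp
  · apply MvPolynomial.coeff_eq_zero_of_totalDegree_lt
    rw [← hd] at h
    exact h

/-- CN for polynomials with degree at most. -/
lemma rs_cn {σ F : Type*} [Finite σ] [Field F] (f : MvPolynomial σ F) (t : σ →₀ ℕ)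
    (ht : f.coeff t ≠ 0) (ht' : f.totalDegree ≤ t.degree)
    (S : σ → Finset F) (htS : ∀ i, t i < (S i).card) :
    ∃ s : σ → F, (∀ i, s i ∈ S i) ∧ MvPolynomial.eval s f ≠ 0 := by
  refine MvPolynomial.combinatorial_nullstellensatz_exists_eval_nonzero f t ht
    (le_antisymm ht' ?_) S htS
  exact MvPolynomial.le_totalDegree (MvPolynomial.mem_support_iff.2 ht)

lemma rs_unique {σ F : Type*} [Fintype σ] [Field F] (f : MvPolynomial σ F) (t : σ →₀ ℕ)
    (ht' : f.totalDegree ≤ t.degree) (B : σ → Finset F) (hB : ∀ i, (B i).card = t i + 1)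
    (a : σ → F) (ha : ∀ i, a i ∈ B i) (hfa : MvPolynomial.eval a f ≠ 0)
    (hu : ∀ x : σ → F, (∀ i, x i ∈ B i) → MvPolynomial.eval x f ≠ 0 → x = a) :
    f.coeff t ≠ 0 := by
  classical
  intro h0
  set s : Finset (Σ _ : σ, F) := Finset.univ.sigma (fun i => (B i).erase (a i)) with hs
  set g : MvPolynomial σ F := ∏ q ∈ s, (MvPolynomial.X q.1 - MvPolynomial.C q.2) with hg
  have hcard : s.card = t.degree := by
    rw [hs, card_sigma, Finsupp.degree_eq_sum]
    refine sum_congr rfl fun i _ => ?_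
    rw [card_erase_of_mem (ha i), hB]; rfl
  have hgd : g.totalDegree ≤ t.degree := by
    rw [← hcard]
    exact rs_prod_deg s (fun q => MvPolynomial.X q.1) (fun q => by simp) (fun q => q.2)
  have hgc : g.coeff t = 1 := by
    rw [hg, rs_coeff s (fun q => MvPolynomial.X q.1) (fun q => by simp) (fun q => q.2)
      (fun _ => 0) t hcard.symm]
    have : ∏ i ∈ s, ((MvPolynomial.X i.1 : MvPolynomial σ F) - MvPolynomial.C 0)
        = MvPolynomial.monomial t 1 := by
      rw [hs, prod_sigma, MvPolynomial.monomial_eq, Finsupp.prod_fintype _ _ (by simp)]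
      simp only [map_zero, sub_zero, prod_const, map_one, one_mul]
      refine prod_congr rfl fun i _ => ?_
      rw [card_erase_of_mem (ha i), hB]; rfl
    rw [this]; simp
  have hge : ∀ x : σ → F, MvPolynomial.eval x g = ∏ q ∈ s, (x q.1 - q.2) := by
    intro x; simp [hg]
  have hga : MvPolynomial.eval a g ≠ 0 := by
    rw [hge, prod_ne_zero_iff]
    rintro ⟨i, b⟩ hq
    simp only [hs, mem_sigma, mem_univ, true_and, mem_erase] at hq
    exact sub_ne_zero.2 (Ne.symm hq.1)
  have hgx : ∀ x : σ → F, (∀ i, x i ∈ B i) → x ≠ a → MvPolynomial.eval x g = 0 := by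
    intro x hx hxa
    obtain ⟨i, hi⟩ := Function.ne_iff.1 hxa
    rw [hge]
    refine prod_eq_zero (i := ⟨i, x i⟩) ?_ (sub_self _)
    simp [hs, hi, hx i]
  set c := MvPolynomial.eval a f / MvPolynomial.eval a g with hc
  have hc0 : c ≠ 0 := div_ne_zero hfa hga
  obtain ⟨x, hx, hxe⟩ := rs_cn (f - MvPolynomial.C c * g) t
    (by simp [h0, hgc, hc0])
    ((MvPolynomial.totalDegree_sub _ _).trans (max_le ht'
      ((MvPolynomial.totalDegree_mul _ _).trans (by simpa using hgd))))
    B (fun i => by rw [hB]; omega)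
  apply hxe
  by_cases hxa : x = a
  · subst hxa
    simp only [map_sub, map_mul, MvPolynomial.eval_C, hc]
    field_simp
    simp
  · have : MvPolynomial.eval x f = 0 := by
      by_contra h
      exact hxa (hu x hx h)
    simp [this, hgx x hx hxa]

lemma rs_transfer {σ ι F : Type*} [Fintype σ] [Fintype ι] [Field F]
    (L : ι → MvPolynomial σ F) (hL : ∀ i, (L i).totalDegree ≤ 1) (b b' : ι → F)
    (t : σ → ℕ) (ht : ∑ i, t i = Fintype.card ι)
    (B : σ → Finset F) (hB : ∀ i, (B i).card = t i + 1)
    (a : σ → F) (ha : ∀ i, a i ∈ B i) (hfa : ∀ q, MvPolynomial.eval a (L q) ≠ b' q)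
    (hu : ∀ x : σ → F, (∀ i, x i ∈ B i) → (∀ q, MvPolynomial.eval x (L q) ≠ b' q) → x = a)
    (A : σ → Finset F) (hA : ∀ i, t i < (A i).card) :
    ∃ x : σ → F, (∀ i, x i ∈ A i) ∧ ∀ q, MvPolynomial.eval x (L q) ≠ b q := by
  classical
  set T : σ →₀ ℕ := Finsupp.equivFunOnFinite.symm t with hT
  have hTd : T.degree = (univ : Finset ι).card := by
    rw [Finsupp.degree_eq_sum]; simpa [hT] using ht
  have hev : ∀ (x : σ → F) (b : ι → F),
      MvPolynomial.eval x (∏ q, (L q - MvPolynomial.C (b q))) ≠ 0 ↔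
        ∀ q, MvPolynomial.eval x (L q) ≠ b q := by
    intro x b
    simp [prod_eq_zero_iff, sub_eq_zero]
  have h1 := rs_unique (∏ q, (L q - MvPolynomial.C (b' q))) T
    (by rw [hTd]; exact rs_prod_deg _ L hL b') B hB a ha ((hev _ _).2 hfa)
    (fun x hx h => hu x hx ((hev _ _).1 h))
  rw [rs_coeff _ L hL b' b T hTd] at h1
  obtain ⟨x, hx, h⟩ := rs_cn _ T h1 (by rw [hTd]; exact rs_prod_deg _ L hL b) A hA
  exact ⟨x, hx, (hev _ _).1 h⟩

lemma rs_enum {F : Type*} [Inhabited F] (C : Finset F) (N : ℕ) (h : C.card ≤ N) :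
    ∃ c : Fin N → F, ∀ x ∈ C, ∃ t, c t = x := by
  refine ⟨fun t => C.toList.getD t default, fun x hx => ?_⟩
  obtain ⟨i, hi, e⟩ := List.getElem_of_mem (Finset.mem_toList.2 hx)
  rw [Finset.length_toList] at hi
  exact ⟨⟨i, by omega⟩, by simp [e, hi]⟩

/-- integer combinatorics -/
lemma rs_comb (n m : ℕ) (x d : Fin n → ℕ) (hd : Antitone d) (D : ℕ)
    (hD : ∀ i, D ≤ d i ∧ d i ≤ D + 1)
    (hx : ∀ i, x i ≤ d i) (hsep : ∀ i j, i < j → x i + m ≤ x j ∨ x j + m + 1 ≤ x i) :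
    (∑ i : Fin n, m * (i : ℕ) ≤ ∑ i, x i) ∧
    (∑ i, x i = ∑ i : Fin n, m * (i : ℕ) → ∀ i : Fin n, x i = m * (i : ℕ)) ∧
    (∑ i, x i + n * (m * (n - 1)) ≤ ∑ i : Fin n, m * (i : ℕ) + ∑ i, d i) := by
  rcases n with _ | n
  · simp
  set σ := Tuple.sort x with hσ
  obtain ⟨hmono, hst⟩ := Tuple.eq_sort_iff.1 hσ
  set z : Fin (n+1) → ℤ := fun t => (x (σ t) : ℤ) - m * (t : ℕ) with hz
  have hg : StrictMono (fun t : Fin (n+1) => ((n : ℤ) + 1) * z t + ((σ t : ℕ) : ℤ)) := by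
    rw [Fin.strictMono_iff_lt_succ]
    intro i
    have hlt : i.castSucc < i.succ := Fin.castSucc_lt_succ
    have h1 : x (σ i.castSucc) ≤ x (σ i.succ) := hmono hlt.le
    have h2 := hst _ _ hlt
    have b1 := (σ i.castSucc).isLt
    have b2 := (σ i.succ).isLt
    have hne : σ i.castSucc ≠ σ i.succ := fun h => hlt.ne (σ.injective h)
    simp only [hz, Fin.val_castSucc, Fin.val_succ]
    push_cast
    rcases lt_or_gt_of_ne hne with h | h
    · have h3 := hsep _ _ h
      have h4 : (x (σ i.castSucc) : ℤ) + m ≤ x (σ i.succ) := by omega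
      have h5 : ((σ i.castSucc : ℕ) : ℤ) < ((σ i.succ : ℕ) : ℤ) := by exact_mod_cast h
      nlinarith
    · have h3 := hsep _ _ h
      have h4 : (x (σ i.castSucc) : ℤ) + m + 1 ≤ x (σ i.succ) := by
        rcases h3 with h3 | h3
        · exact absurd (h2 (by omega)) (not_lt.2 h.le)
        · omega
      nlinarith
  have hle : ∀ s t, s ≤ t → z s ≤ z t := by
    intro s t hst
    have := hg.monotone hst
    have b1 := (σ s).isLt
    have b2 := (σ t).isLt
    by_contra! hh
    nlinarith
  have hlt : ∀ s t, s ≤ t → σ t < σ s → z s < z t := by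
    intro s t hst h
    have := hg.monotone hst
    have h5 : ((σ t : ℕ) : ℤ) < ((σ s : ℕ) : ℤ) := by exact_mod_cast h
    by_contra! hh
    nlinarith
  have hz0 : ∀ t, 0 ≤ z t := by
    intro t
    refine le_trans ?_ (hle 0 t (Fin.zero_le t))
    simp [hz]
  have hsum : ∑ i, (x i : ℤ) = ∑ t, z t + ∑ i : Fin (n+1), (m : ℤ) * (i : ℕ) := by
    rw [← Equiv.sum_comp σ (fun i => (x i : ℤ)), ← sum_add_distrib]
    simp [hz]
  have hub : ∀ t, z t ≤ d (σ t) - m * n := by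
    intro t
    have hl := hle t (Fin.last n) (Fin.le_last t)
    have h1 : z (Fin.last n) ≤ d (σ (Fin.last n)) - m * n := by
      have := hx (σ (Fin.last n))
      simp only [hz, Fin.val_last]
      omega
    rcases le_or_gt (σ t) (σ (Fin.last n)) with h | h
    · have := hd h
      omega
    · have := hlt t (Fin.last n) (Fin.le_last t) h
      have := hD (σ t)
      have := hD (σ (Fin.last n))
      omega
  refine ⟨?_, ?_, ?_⟩
  · zify
    rw [hsum]
    linarith [sum_nonneg (fun t (_ : t ∈ univ) => hz0 t)]
  · intro h
    zify at h
    rw [hsum] at h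
    have h0 : ∑ t, z t = 0 := by linarith
    rw [sum_eq_zero_iff_of_nonneg (fun t _ => hz0 t)] at h0
    have hσm : StrictMono σ := by
      intro s t hst
      have := hg hst
      simp only [h0 s (mem_univ _), h0 t (mem_univ _)] at this
      have h' : ((σ s : ℕ) : ℤ) < ((σ t : ℕ) : ℤ) := by linarith
      exact_mod_cast h'
    have hid : ∀ i, σ i = i := by
      intro i
      have := (hσm.range_inj strictMono_id).1 (by simp [σ.surjective.range_eq])
      exact congrFun this i
    intro i
    have := h0 i (mem_univ _)
    simp only [hz, hid] at this
    zify
    linarith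
  · zify
    rw [hsum]
    clear_value z
    have : ∑ t, z t ≤ ∑ t, ((d (σ t) : ℤ) - m * n) := sum_le_sum (fun t (_ : t ∈ univ) => hub t)
    rw [sum_sub_distrib, Equiv.sum_comp σ (fun i => (d i : ℤ))] at this
    simp only [sum_const, card_univ, Fintype.card_fin, nsmul_eq_mul] at this
    push_cast at this ⊢
    linarith

lemma rs_model {F : Type*} [Field F] [DecidableEq F] (n m : ℕ) (hn : 1 ≤ n) (p : ℕ) [CharP F p]
    (hp : m * n < p) (q r : ℕ) (hr : r < n) (hqr : p - 1 = n * q + r)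
    (S : Fin n → Fin n → Finset F) (hS : ∀ i j : Fin n, i ≠ j → (S i j).card = m)
    (A : Fin n → Finset F) (hA : ∀ j, m * (n - 1) + q + 1 < (A j).card)
    (C : Finset F) (hC : C.card ≤ p - 1) :
    ∃ f : Fin n → F, (∀ i, f i ∈ A i) ∧ (∀ i j : Fin n, i ≠ j → f i - f j ∉ S i j) ∧
      ∑ i, f i ∉ C := by
  classical
  have : Inhabited F := ⟨0⟩
  let ι := ({e : Fin n × Fin n // e.1 ≠ e.2} × Fin m) ⊕ Fin (p - 1)
  let L : ι → MvPolynomial (Fin n) F := Sum.elim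
    (fun e => MvPolynomial.X e.1.1.1 - MvPolynomial.X e.1.1.2) (fun _ => ∑ i, MvPolynomial.X i)
  have hL : ∀ e, (L e).totalDegree ≤ 1 := by
    rintro (e | e)
    · exact (MvPolynomial.totalDegree_sub _ _).trans (by simp)
    · refine (MvPolynomial.totalDegree_finsetSum _ _).trans ?_
      simp
  choose c hc using rs_enum C (p - 1) hC
  have hs' : ∀ i j : Fin n, ∃ c : Fin m → F, i ≠ j → ∀ x ∈ S i j, ∃ t, c t = x := by
    intro i j
    by_cases h : i = j
    · exact ⟨fun _ => 0, fun h' => absurd h h'⟩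
    · obtain ⟨c, hc⟩ := rs_enum (S i j) m (hS i j h).le
      exact ⟨c, fun _ => hc⟩
  choose s hs using hs'
  let b : ι → F := Sum.elim (fun e => s e.1.1.1 e.1.1.2 e.2) c
  let c0 : ℕ := ∑ i : Fin n, m * (i : ℕ)
  let b' : ι → F := Sum.elim
    (fun e => if e.1.1.2 < e.1.1.1 then ((e.2 : ℕ) : F) else (((e.2 : ℕ) + 1 : ℕ) : F))
    (fun t => ((c0 + (t : ℕ) + 1 : ℕ) : F))
  let D := m * (n - 1) + q
  let d : Fin n → ℕ := fun i => if (i : ℕ) < r then D + 1 else D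
  have hmn : m * (n - 1) + m = m * n := by
    obtain ⟨k, rfl⟩ : ∃ k, n = k + 1 := ⟨n - 1, by omega⟩
    simp; ring
  have hdp : ∀ i, d i < p := by
    have hmq : m ≤ q := by
      by_contra! h
      have : (q + 1) * n ≤ m * n := Nat.mul_le_mul_right _ h
      have : (q + 1) * n = n * q + n := by ring
      omega
    have hDq : D ≤ n * q := by
      have h1 : m * (n - 1) ≤ q * (n - 1) := Nat.mul_le_mul_right _ hmq
      obtain ⟨k, rfl⟩ : ∃ k, n = k + 1 := ⟨n - 1, by omega⟩
      simp only [D]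
      simp only [add_tsub_cancel_right] at h1 ⊢
      nlinarith
    intro i
    simp only [d]
    split_ifs <;> omega
  have hdD : ∀ i, D ≤ d i ∧ d i ≤ D + 1 := by
    intro i; simp only [d]; split_ifs <;> omega
  have hdanti : Antitone d := by
    intro i j hij
    have : (i : ℕ) ≤ j := hij
    simp only [d]; split_ifs <;> omega
  have hdsum : ∑ i, d i = n * D + r := by
    have : ∀ i, d i = D + if (i : ℕ) < r then 1 else 0 := by
      intro i; simp only [d]; split_ifs <;> rfl
    simp only [this, sum_add_distrib, sum_const, card_univ, Fintype.card_fin, smul_eq_mul]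
    congr 1
    rw [Fin.sum_univ_eq_sum_range (fun i => if i < r then 1 else 0) n, ← sum_filter]
    rw [sum_const, smul_eq_mul, mul_one]
    have : (range n).filter (fun i => i < r) = range r := by
      ext i; simp; omega
    rw [this, card_range]
  have hcardι : Fintype.card ι = n * (n - 1) * m + (p - 1) := by
    have h1 : Fintype.card {e : Fin n × Fin n // e.1 ≠ e.2} = n * (n - 1) := by
      rw [Fintype.card_of_subtype (univ : Finset (Fin n)).offDiag (by simp), offDiag_card]
      simp [Nat.mul_sub]
    simp only [ι, Fintype.card_sum, Fintype.card_prod, h1, Fintype.card_fin]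
  have hinj : ∀ u v : ℤ, (u : F) = v → |u - v| < p → u = v := by
    intro u v huv h
    have h1 : ((u - v : ℤ) : F) = 0 := by push_cast; rw [huv, sub_self]
    rw [CharP.intCast_eq_zero_iff F p] at h1
    have := Int.eq_zero_of_abs_lt_dvd h1 h
    linarith
  have hinjN : ∀ u v : ℕ, u < p → v < p → (u : F) = v → u = v := by
    intro u v hu hv h
    have := hinj u v (by exact_mod_cast h) (by rw [abs_lt]; constructor <;> linarith)
    exact_mod_cast this
  obtain ⟨f, hfA, hf⟩ := rs_transfer L hL b b' d
    (by rw [hdsum, hcardι, hqr]; simp only [D]; ring)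
    (fun i => (range (d i + 1)).image (fun u : ℕ => (u : F)))
    (fun i => by
      rw [card_image_of_injOn, card_range]
      intro u hu v hv h
      have := hdp i
      simp only [coe_range, Set.mem_Iio] at hu hv
      exact hinjN u v (by omega) (by omega) h)
    (fun i => ((m * (i : ℕ) : ℕ) : F))
    (fun i => by
      refine mem_image_of_mem _ ?_
      have h1 : m * (i : ℕ) ≤ m * (n - 1) := Nat.mul_le_mul_left _ (by omega)
      have := (hdD i).1
      simp only [D] at this
      rw [mem_range]; omega)
    (by
      rintro (⟨⟨⟨i, j⟩, hij⟩, t⟩ | t) h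
      · have ht := t.isLt
        have hi : m * ((i : ℕ) + 1) ≤ m * n := Nat.mul_le_mul_left _ (by omega)
        have hj : m * ((j : ℕ) + 1) ≤ m * n := Nat.mul_le_mul_left _ (by omega)
        simp only [mul_add, mul_one] at hi hj
        simp only [L, b', Sum.elim_inl, map_sub, MvPolynomial.eval_X] at h
        split_ifs at h with hlt
        · have h1 : m * ((j : ℕ) + 1) ≤ m * (i : ℕ) := Nat.mul_le_mul_left _ hlt
          rw [mul_add, mul_one] at h1
          rw [sub_eq_iff_eq_add] at h
          have := hinjN (m * i) (t + m * j) (by omega) (by omega) (by push_cast at h ⊢; exact h)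
          omega
        · have hlt' : i < j := lt_of_le_of_ne (not_lt.1 hlt) hij
          have h1 : m * ((i : ℕ) + 1) ≤ m * (j : ℕ) := Nat.mul_le_mul_left _ hlt'
          rw [mul_add, mul_one] at h1
          rw [sub_eq_iff_eq_add] at h
          have := hinjN (m * i) (t + 1 + m * j) (by omega) (by omega)
            (by push_cast at h ⊢; exact h)
          omega
      · have ht := t.isLt
        simp only [L, b', Sum.elim_inr, map_sum, MvPolynomial.eval_X] at h
        rw [← Nat.cast_sum] at h
        have h2 : ((c0 : ℤ) : F) = ((c0 + t + 1 : ℕ) : ℤ) := by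
          rw [Int.cast_natCast, Int.cast_natCast]; exact h
        have := hinj _ _ h2 (by rw [abs_lt]; constructor <;> push_cast <;> omega)
        omega)
    (by
      intro x hx hne
      have hx' : ∀ i, ∃ u : ℕ, u ≤ d i ∧ (u : F) = x i := by
        intro i
        obtain ⟨u, hu, h⟩ := mem_image.1 (hx i)
        rw [mem_range] at hu
        exact ⟨u, by omega, h⟩
      choose y hy hyx using hx'
      have hsep : ∀ i j, i < j → y i + m ≤ y j ∨ y j + m + 1 ≤ y i := by
        intro i j hij
        by_contra! hcon
        rcases le_or_gt (y i) (y j) with hle | hgt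
        · have := hne (Sum.inl (⟨(j, i), hij.ne'⟩, ⟨y j - y i, by omega⟩))
          simp only [L, b', Sum.elim_inl, map_sub, MvPolynomial.eval_X, if_pos hij] at this
          apply this
          rw [← hyx, ← hyx, Nat.cast_sub hle]
        · have := hne (Sum.inl (⟨(i, j), hij.ne⟩, ⟨y i - y j - 1, by omega⟩))
          simp only [L, b', Sum.elim_inl, map_sub, MvPolynomial.eval_X, if_neg hij.not_gt] at this
          apply this
          rw [← hyx, ← hyx, Nat.sub_add_cancel (by omega), Nat.cast_sub hgt.le]
      obtain ⟨k1, k2, k3⟩ := rs_comb n m y d hdanti D hdD hy hsep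
      have hk : ∑ i, y i = c0 := by
        by_contra hcon
        have k3' : ∑ i, y i ≤ c0 + (p - 1) := by
          rw [hdsum] at k3
          have : n * D = n * (m * (n - 1)) + n * q := by simp only [D]; ring
          simp only [c0]
          omega
        have k1' : c0 ≤ ∑ i, y i := k1
        have := hne (Sum.inr ⟨∑ i, y i - c0 - 1, by omega⟩)
        simp only [L, b', Sum.elim_inr, map_sum, MvPolynomial.eval_X] at this
        apply this
        rw [show c0 + (∑ i, y i - c0 - 1) + 1 = ∑ i, y i by omega, Nat.cast_sum]
        exact sum_congr rfl fun i _ => (hyx i).symm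
      funext i
      rw [← hyx, k2 hk i])
    A (fun i => lt_of_le_of_lt (hdD i).2 (hA i))
  refine ⟨f, hfA, ?_, ?_⟩
  · intro i j hij hmem
    obtain ⟨t, ht⟩ := hs i j hij _ hmem
    have := hf (Sum.inl (⟨(i, j), hij⟩, t))
    simp only [L, b, Sum.elim_inl, map_sub, MvPolynomial.eval_X] at this
    exact this ht.symm
  · intro hmem
    obtain ⟨t, ht⟩ := hc _ hmem
    have := hf (Sum.inr t)
    simp only [L, b, Sum.elim_inr, map_sum, MvPolynomial.eval_X] at this
    exact this ht.symm

/-- If `mn < p(F) ≤ n(k-1) - mn(n-1)` (so in particular `p(F)` is finite, i.e.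
`ringChar F ≠ 0`), then `|C| ≥ p(F)`; in particular `C = F` when `F` is finite of
prime order (i.e. `Nat.card F = ringChar F`). -/
theorem restricted_sumset_small_char {F : Type*} [Field F] [DecidableEq F] (n m k : ℕ)
    (hn : 1 ≤ n)
    (S : Fin n → Fin n → Finset F) (hS : ∀ i j : Fin n, i ≠ j → (S i j).card = m)
    (A : Fin n → Finset F) (hAk : ∀ j, (A j).card = k)
    (hchar : ringChar F ≠ 0) (hp1 : m * n < ringChar F)
    (hp2 : (ringChar F : ℤ) ≤ (n : ℤ) * (k - 1) - m * n * (n - 1)) :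
    (ringChar F : ℤ) ≤
      (((Fintype.piFinset A).filter fun f => ∀ i j : Fin n, i ≠ j → f i - f j ∉ S i j).image
        fun f => ∑ i, f i).card ∧
    (Nat.card F = ringChar F →
      (((((Fintype.piFinset A).filter fun f => ∀ i j : Fin n, i ≠ j → f i - f j ∉ S i j).image
        fun f => ∑ i, f i) : Finset F) : Set F) = Set.univ) := by
  have hmain : ringChar F ≤
      (((Fintype.piFinset A).filter fun f => ∀ i j : Fin n, i ≠ j → f i - f j ∉ S i j).image
        fun f => ∑ i, f i).card := by
    by_contra! hcon
    have : CharP F (ringChar F) := ringChar.charP F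
    have hdm := Nat.div_add_mod (ringChar F - 1) n
    have hr := Nat.mod_lt (ringChar F - 1) (show n > 0 by omega)
    obtain ⟨f, hfA, hfS, hfC⟩ := rs_model n m hn (ringChar F) hp1 ((ringChar F - 1) / n)
      ((ringChar F - 1) % n) hr hdm.symm S hS A (by
        intro j
        rw [hAk]
        generalize (ringChar F - 1) / n = q at *
        generalize (ringChar F - 1) % n = r at *
        by_contra! hk
        zify [hn] at hk
        have h1 : ((n : ℤ)) * (k - 1) ≤ n * (m * (n - 1) + q) :=
          mul_le_mul_of_nonneg_left (by linarith) (by positivity)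
        have h2 : (n : ℤ) * q + r = ringChar F - 1 := by
          have : n * q + r + 1 = ringChar F := by omega
          have : ((n * q + r + 1 : ℕ) : ℤ) = ringChar F := by rw [this]
          push_cast at this
          linarith
        nlinarith) _ (Nat.le_sub_one_of_lt hcon)
    apply hfC
    refine mem_image.2 ⟨f, ?_, rfl⟩
    rw [mem_filter, Fintype.mem_piFinset]
    exact ⟨hfA, hfS⟩
  refine ⟨by exact_mod_cast hmain, fun hcard => ?_⟩
  have : Finite F := Nat.finite_of_card_ne_zero (by rw [hcard]; exact hchar)
  have := Fintype.ofFinite F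
  rw [coe_eq_univ]
  apply Finset.eq_univ_of_card
  apply le_antisymm (card_le_univ _)
  rw [← Nat.card_eq_fintype_card, hcard]
  exact hmain
end
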